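/- Let c₁, c₂ ∈ ℂ and Q(w) = (w² + c₁)² + c₂. If there exists a critical point w of Q (i.e. Q′(w) = 0) whose orbit (Q^{∘n}(w)) is unbounded, then the alternated filled Julia set K_{P_{c₁c₂}} is disconnected, i.e. K_{P_{c₁c₂}} is not a connected subset of ℂ. -/

import Mathlib

/-- The alternated orbit of `z₀` with parameters `c₁, c₂`:
`z_{n+1} = zₙ² + c₁` if `n` is even, `z_{n+1} = zₙ² + c₂` if `n` is odd. -/
def altOrbit (c₁ c₂ z₀ : ℂ) : ℕ → ℂ
  | 0 => z₀
  | n + 1 => if Even n then (altOrbit c₁ c₂ z₀ n) ^ 2 + c₁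
             else (altOrbit c₁ c₂ z₀ n) ^ 2 + c₂

/-- The alternated filled Julia set `K_{P_{c₁ c₂}}`. -/
def altK (c₁ c₂ : ℂ) : Set ℂ :=
  {z₀ | Bornology.IsBounded (Set.range (altOrbit c₁ c₂ z₀))}

theorem altOrbit_shift (c₁ c₂ z : ℂ) (n : ℕ) :
    altOrbit c₁ c₂ z (n + 1) = altOrbit c₂ c₁ (z ^ 2 + c₁) n := by
  induction n with
  | zero => simp [altOrbit]
  | succ n ih =>
    rw [altOrbit, ih]
    conv_rhs => rw [altOrbit]
    by_cases h : Even n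
    · have : ¬ Even (n + 1) := by simpa [Nat.even_add_one] using h
      simp [h, this]
    · have : Even (n + 1) := by simpa [Nat.even_add_one] using h
      simp [h, this]

theorem altOrbit_step_norm (c₁ c₂ z : ℂ) (n : ℕ) :
    ‖altOrbit c₁ c₂ z n‖ ^ 2 - (‖c₁‖ + ‖c₂‖) ≤ ‖altOrbit c₁ c₂ z (n + 1)‖ := by
  have key : ∀ x c : ℂ, ‖x‖ ^ 2 - ‖c‖ ≤ ‖x ^ 2 + c‖ := by
    intro x c
    have := norm_sub_le (x ^ 2 + c) c
    rw [add_sub_cancel_right, norm_pow] at this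
    linarith
  rw [altOrbit]
  split_ifs
  · have := key (altOrbit c₁ c₂ z n) c₁
    linarith [norm_nonneg c₂]
  · have := key (altOrbit c₁ c₂ z n) c₂
    linarith [norm_nonneg c₁]

theorem mem_altK_iff (c₁ c₂ z : ℂ) :
    z ∈ altK c₁ c₂ ↔ ∀ n, ‖altOrbit c₁ c₂ z n‖ ≤ 2 + ‖c₁‖ + ‖c₂‖ := by
  constructor
  · intro hz n
    by_contra! hn
    obtain ⟨B, hB⟩ := isBounded_iff_forall_norm_le.1 (show Bornology.IsBounded (Set.range (altOrbit c₁ c₂ z)) from hz)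
    have grow : ∀ m : ℕ, 2 + ‖c₁‖ + ‖c₂‖ < ‖altOrbit c₁ c₂ z (n + m)‖ ∧
        (2 : ℝ) ^ m ≤ ‖altOrbit c₁ c₂ z (n + m)‖ := by
      intro m
      have h1 := norm_nonneg c₁
      have h2 := norm_nonneg c₂
      induction m with
      | zero =>
        refine ⟨hn, ?_⟩
        simp only [pow_zero, add_zero]
        linarith
      | succ m ih =>
        have hs := altOrbit_step_norm c₁ c₂ z (n + m)
        rw [← add_assoc]
        obtain ⟨i1, i2⟩ := ih
        have : 2 * ‖altOrbit c₁ c₂ z (n + m)‖ ≤ ‖altOrbit c₁ c₂ z (n + m + 1)‖ := by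
          nlinarith
        refine ⟨by linarith, ?_⟩
        rw [pow_succ]
        linarith
    obtain ⟨m, hm⟩ := pow_unbounded_of_one_lt B (one_lt_two : (1 : ℝ) < 2)
    have := hB _ (Set.mem_range_self (n + m))
    linarith [(grow m).2]
  · intro h
    change Bornology.IsBounded (Set.range (altOrbit c₁ c₂ z))
    refine isBounded_iff_forall_norm_le.2 ⟨2 + ‖c₁‖ + ‖c₂‖, ?_⟩
    rintro _ ⟨n, rfl⟩
    exact h n

theorem altOrbit_differentiable (c₁ c₂ : ℂ) (n : ℕ) :
    Differentiable ℂ (fun z => altOrbit c₁ c₂ z n) := by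
  induction n with
  | zero => simpa [altOrbit] using differentiable_id
  | succ n ih =>
    by_cases h : Even n
    · simp only [altOrbit, h, if_true]
      exact (ih.pow 2).add_const _
    · simp only [altOrbit, h, if_false]
      exact (ih.pow 2).add_const _

theorem altK_isClosed (c₁ c₂ : ℂ) : IsClosed (altK c₁ c₂) := by
  have : altK c₁ c₂ = ⋂ n, {z | ‖altOrbit c₁ c₂ z n‖ ≤ 2 + ‖c₁‖ + ‖c₂‖} := by
    ext z
    simp [mem_altK_iff]
  rw [this]
  exact isClosed_iInter fun n =>
    isClosed_le (altOrbit_differentiable c₁ c₂ n).continuous.norm continuous_const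

theorem altK_shift (c₁ c₂ z : ℂ) : z ∈ altK c₁ c₂ ↔ z ^ 2 + c₁ ∈ altK c₂ c₁ := by
  constructor
  · intro h
    rw [mem_altK_iff] at h ⊢
    intro n
    rw [← altOrbit_shift]
    linarith [h (n + 1)]
  · intro h
    obtain ⟨B, hB⟩ := isBounded_iff_forall_norm_le.1 (show Bornology.IsBounded (Set.range (altOrbit c₂ c₁ (z ^ 2 + c₁))) from h)
    change Bornology.IsBounded (Set.range (altOrbit c₁ c₂ z))
    refine isBounded_iff_forall_norm_le.2 ⟨max B ‖z‖, ?_⟩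
    rintro _ ⟨n, rfl⟩
    cases n with
    | zero => exact le_max_right _ _
    | succ n =>
      rw [altOrbit_shift]
      exact (hB _ (Set.mem_range_self n)).trans (le_max_left _ _)

/-- `z - a` has a continuous square root on `K`. -/
def HasRoot (K : Set ℂ) (a : ℂ) : Prop :=
  ∃ s : ℂ → ℂ, ContinuousOn s K ∧ ∀ z ∈ K, s z ^ 2 = z - a

theorem root_aux {K : Set ℂ} {g : ℂ → ℂ} (hg : ContinuousOn g K) (h : ∀ z ∈ K, ‖g z‖ < 1) :
    ∃ s : ℂ → ℂ, ContinuousOn s K ∧ ∀ z ∈ K, s z ^ 2 = 1 + g z := by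
  have hs : ∀ z ∈ K, 1 + g z ∈ Complex.slitPlane := fun z hz =>
    Complex.mem_slitPlane_of_norm_lt_one (h z hz)
  refine ⟨fun z => Complex.exp (Complex.log (1 + g z) / 2), ?_, ?_⟩
  · exact ((ContinuousOn.clog (continuousOn_const.add hg) hs).div_const 2).cexp
  · intro z hz
    rw [← Complex.exp_nat_mul]
    push_cast
    rw [mul_div_cancel₀ _ two_ne_zero, Complex.exp_log (Complex.slitPlane_ne_zero (hs z hz))]

theorem HasRoot.move {K : Set ℂ} {a b : ℂ} (ha : HasRoot K a)
    (h : ∀ z ∈ K, ‖a - b‖ < ‖z - a‖) : HasRoot K b := by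
  obtain ⟨s, hs, hs2⟩ := ha
  have hne : ∀ z ∈ K, z - a ≠ 0 := fun z hz =>
    norm_pos_iff.1 ((norm_nonneg _).trans_lt (h z hz))
  obtain ⟨t, ht, ht2⟩ := root_aux (K := K) (g := fun z => (a - b) / (z - a))
    (continuousOn_const.div (continuousOn_id.sub continuousOn_const) hne) (by
      intro z hz
      rw [norm_div, div_lt_one (norm_pos_iff.2 (hne z hz))]
      exact h z hz)
  refine ⟨fun z => s z * t z, hs.mul ht, fun z hz => ?_⟩
  have := hne z hz
  rw [mul_pow, hs2 z hz, ht2 z hz]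
  field_simp
  ring

theorem hasRoot_far {K : Set ℂ} {a : ℂ} (h : ∀ z ∈ K, ‖z‖ < ‖a‖) : HasRoot K a := by
  by_cases ha : a = 0
  · subst ha
    refine ⟨id, continuousOn_id, fun z hz => ?_⟩
    have := h z hz
    rw [norm_zero] at this
    exact absurd this (not_lt.2 (norm_nonneg z))
  obtain ⟨t, ht, ht2⟩ := root_aux (K := K) (g := fun z => z / (-a))
    (continuousOn_id.div_const _) (by
      intro z hz
      rw [norm_div, norm_neg, div_lt_one (norm_pos_iff.2 ha)]
      exact h z hz)
  obtain ⟨r, hr⟩ := IsAlgClosed.exists_pow_nat_eq (-a) two_pos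
  refine ⟨fun z => r * t z, continuousOn_const.mul ht, fun z hz => ?_⟩
  rw [mul_pow, hr, ht2 z hz]
  field_simp
  ring

theorem hasRoot_altK (c₁ c₂ a : ℂ) (ha : a ∉ altK c₁ c₂) : HasRoot (altK c₁ c₂) a := by
  by_contra hna
  set K := altK c₁ c₂ with hK
  have hloc : ∀ x, x ∉ K → ∃ r > 0, ∀ y, dist y x < r → y ∉ K ∧ (HasRoot K x ↔ HasRoot K y) := by
    intro x hx
    obtain ⟨r, hr, hball⟩ := Metric.isOpen_iff.1 (altK_isClosed c₁ c₂).isOpen_compl x hx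
    have hfar : ∀ z ∈ K, r ≤ ‖z - x‖ := by
      intro z hz
      by_contra! hlt
      exact hball (by rwa [Metric.mem_ball, dist_eq_norm]) hz
    refine ⟨r / 2, by positivity, fun y hy => ⟨?_, ?_, ?_⟩⟩
    · exact hball (Metric.mem_ball.2 (by linarith))
    · intro h
      refine h.move fun z hz => ?_
      rw [← dist_eq_norm, dist_comm]
      linarith [hfar z hz]
    · intro h
      refine h.move fun z hz => ?_
      rw [← dist_eq_norm]
      have h1 := hfar z hz
      rw [← dist_eq_norm] at h1 ⊢
      linarith [dist_triangle z y x]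
  let V : Set ℂ := {x | x ∉ K ∧ ¬ HasRoot K x}
  have hVo : IsOpen V := by
    rw [Metric.isOpen_iff]
    rintro x ⟨hx, hx2⟩
    obtain ⟨r, hr, h⟩ := hloc x hx
    exact ⟨r, hr, fun y hy => ⟨(h y hy).1, fun h' => hx2 ((h y hy).2.2 h')⟩⟩
  have hVb : Bornology.IsBounded V := by
    refine isBounded_iff_forall_norm_le.2 ⟨2 + ‖c₁‖ + ‖c₂‖, ?_⟩
    rintro x ⟨hx, hx2⟩
    by_contra! hlt
    exact hx2 (hasRoot_far fun z hz => lt_of_le_of_lt ((mem_altK_iff c₁ c₂ z).1 hz 0) hlt)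
  have hfr : frontier V ⊆ K := by
    intro x hx
    by_contra hxK
    rw [hVo.frontier_eq] at hx
    obtain ⟨r, hr, h⟩ := hloc x hxK
    obtain ⟨y, hyV, hy⟩ := Metric.mem_closure_iff.1 hx.1 r hr
    rw [dist_comm] at hy
    exact hx.2 ⟨hxK, fun h' => hyV.2 ((h y hy).2.1 h')⟩
  apply ha
  rw [hK, mem_altK_iff]
  intro n
  exact Complex.norm_le_of_forall_mem_frontier_norm_le hVb
    (altOrbit_differentiable c₁ c₂ n).diffContOnCl
    (fun z hz => (mem_altK_iff c₁ c₂ z).1 (hfr hz) n) (subset_closure (show a ∈ V from ⟨ha, hna⟩))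

theorem not_connected_of_zero (c₁ c₂ : ℂ) (h0 : (0 : ℂ) ∉ altK c₁ c₂) :
    ¬ IsConnected (altK c₁ c₂) := by
  rintro ⟨⟨z, hz⟩, hc⟩
  have hc1 : c₁ ∉ altK c₂ c₁ := by
    intro h
    exact h0 ((altK_shift c₁ c₂ 0).2 (by simpa using h))
  obtain ⟨s, hs, hs2⟩ := hasRoot_altK c₂ c₁ c₁ hc1
  have hne : ∀ x ∈ altK c₁ c₂, x ≠ 0 := fun x hx h => h0 (h ▸ hx)
  have hsq : ∀ x ∈ altK c₁ c₂, s (x ^ 2 + c₁) ^ 2 = x ^ 2 := fun x hx => by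
    rw [hs2 _ ((altK_shift c₁ c₂ x).1 hx)]
    ring
  have hneg : -z ∈ altK c₁ c₂ := by
    rw [altK_shift, neg_sq]
    exact (altK_shift c₁ c₂ z).1 hz
  have hcont : ContinuousOn (fun x => s (x ^ 2 + c₁)) (altK c₁ c₂) :=
    hs.comp (by fun_prop) (fun x hx => (altK_shift c₁ c₂ x).1 hx)
  have hz0 := hne z hz
  rcases hc.eq_or_eq_neg_of_sq_eq hcont continuousOn_id (fun x hx => hsq x hx)
    (fun {x} hx => hne x hx) with h | h
  · have h1 := h hz
    have h2 := h hneg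
    simp only [neg_sq, id] at h1 h2
    exact hz0 (self_eq_neg.1 (h1.symm.trans h2))
  · have h1 := h hz
    have h2 := h hneg
    simp only [neg_sq, id, Pi.neg_apply, neg_neg] at h1 h2
    exact hz0 (self_eq_neg.1 (h2.symm.trans h1))

theorem stmt_15 (c₁ c₂ : ℂ)
    (h : ∃ w : ℂ, deriv (fun w : ℂ => (w ^ 2 + c₁) ^ 2 + c₂) w = 0 ∧
      ¬ Bornology.IsBounded
        (Set.range fun n : ℕ => (fun w : ℂ => (w ^ 2 + c₁) ^ 2 + c₂)^[n] w)) :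
    ¬ IsConnected (altK c₁ c₂) := by
  obtain ⟨w, hd, hb⟩ := h
  have hiter : ∀ (n : ℕ) (x : ℂ), (fun w : ℂ => (w ^ 2 + c₁) ^ 2 + c₂)^[n] x
      = altOrbit c₁ c₂ x (2 * n) := by
    intro n
    induction n with
    | zero => intro x; simp [altOrbit]
    | succ n ih =>
      intro x
      rw [Function.iterate_succ_apply, ih, show 2 * (n + 1) = 2 * n + 1 + 1 by ring,
        altOrbit_shift, altOrbit_shift]
  have hw : w ∉ altK c₁ c₂ := by
    intro hw
    refine hb (Bornology.IsBounded.subset (show Bornology.IsBounded (Set.range (altOrbit c₁ c₂ w)) from hw) ?_)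
    rintro _ ⟨n, rfl⟩
    exact ⟨2 * n, (hiter n w).symm⟩
  have hder : deriv (fun w : ℂ => (w ^ 2 + c₁) ^ 2 + c₂) w = 2 * (w ^ 2 + c₁) * (2 * w) := by
    have h1 : HasDerivAt (fun w : ℂ => (w ^ 2 + c₁) ^ 2 + c₂) _ w :=
      ((((hasDerivAt_id w).pow 2).add_const c₁).pow 2).add_const c₂
    rw [h1.deriv]
    simp
  rw [hder] at hd
  have hcases : w = 0 ∨ w ^ 2 + c₁ = 0 := by
    rcases mul_eq_zero.1 hd with h | h
    · exact Or.inr ((mul_eq_zero.1 h).resolve_left two_ne_zero)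
    · exact Or.inl ((mul_eq_zero.1 h).resolve_left two_ne_zero)
  rcases hcases with h | h
  · exact not_connected_of_zero c₁ c₂ (h ▸ hw)
  · intro hconn
    refine not_connected_of_zero c₂ c₁ (fun h0 => hw ?_) ?_
    · rw [altK_shift, h]
      exact h0
    · have him : (fun z : ℂ => z ^ 2 + c₁) '' altK c₁ c₂ = altK c₂ c₁ := by
        ext y
        constructor
        · rintro ⟨x, hx, rfl⟩
          exact (altK_shift c₁ c₂ x).1 hx
        · intro hy
          obtain ⟨x, hx⟩ := IsAlgClosed.exists_pow_nat_eq (y - c₁) two_pos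
          have hxy : x ^ 2 + c₁ = y := by rw [hx]; ring
          exact ⟨x, (altK_shift c₁ c₂ x).2 (hxy ▸ hy), hxy⟩
      rw [← him]
      exact hconn.image _ (by fun_prop)
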